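/- Let n ≥ 2 and fix signs ε_1,…,ε_n ∈ {1,−1}. There is a constant C > 0 such that for every real p with p ≥ 2 and np ≥ 6, every j ∈ ℤ, every unit vector e ∈ S^{n−1}, and every φ ∈ L²(ℝⁿ), the maximal function estimate 2^{−(n/2−1/p)j} ‖P_j W_±(t)φ‖_{L^{p,∞}_e} ≤ C‖φ‖_{L²} holds, where the left-hand side involves the L^{p,∞}_e norm of the space-time function (t,x) ↦ (P_j W_±(t)φ)(x), and C is independent of j, p, e and φ. -/

import Mathlib

open MeasureTheory Complex Filter
open scoped FourierTransform RealInnerProductSpace ENNReal NNReal Topology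

noncomputable section

namespace DNLS

/-- Euclidean space ℝⁿ. -/
abbrev Eucl (n : ℕ) := EuclideanSpace ℝ (Fin n)

/-- The quadratic symbol `|ξ|²_± = Σ εᵢ ξᵢ²`. -/
def quadSym {n : ℕ} (ε : Fin n → ℝ) (ξ : Eucl n) : ℝ := ∑ i, ε i * (ξ i) ^ 2

/-- The signed vector `e_± = (ε₁e₁, …, εₙeₙ)`. -/
def epm {n : ℕ} (ε : Fin n → ℝ) (e : Eucl n) : Eucl n := WithLp.toLp 2 (fun i => ε i * e i)

/-- Fourier multiplier operator with symbol `m`. -/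
def mulOp {n : ℕ} (m : Eucl n → ℂ) (f : Eucl n → ℂ) : Eucl n → ℂ :=
  𝓕⁻ (fun ξ => m ξ * 𝓕 f ξ)

/-- The propagator `W_±(t)`, with `(W_±(t)φ)^(ξ) = e^{-it|ξ|²_±} φ̂(ξ)`. -/
def prop {n : ℕ} (ε : Fin n → ℝ) (t : ℝ) (φ : Eucl n → ℂ) : Eucl n → ℂ :=
  mulOp (fun ξ => Complex.exp (-Complex.I * t * quadSym ε ξ)) φ

/-- Fourier multiplier operator acting in the space variable of a space-time function. -/
def mulOpT {n : ℕ} (m : Eucl n → ℂ) (u : ℝ × Eucl n → ℂ) : ℝ × Eucl n → ℂ :=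
  fun p => mulOp m (fun y => u (p.1, y)) p.2

/-- Hypotheses on the bump function χ : even, smooth, compactly supported in (-2,2),
equal to one on [-1,1]. -/
structure IsBump (χ : ℝ → ℝ) : Prop where
  smooth : ∀ k : ℕ, ContDiff ℝ k χ
  even : ∀ s, χ (-s) = χ s
  supp : ∀ s, 2 ≤ |s| → χ s = 0
  one : ∀ s, |s| ≤ 1 → χ s = 1

/-- `ψ(s) = χ(|s|) - χ(2|s|)`. -/
def psiR (χ : ℝ → ℝ) (s : ℝ) : ℝ := χ |s| - χ (2 * |s|)

/-- `ψ_{≥k}(s) = Σ_{m ≥ k} ψ(2^{-m} s)`. -/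
def psiGe (χ : ℝ → ℝ) (k : ℤ) (s : ℝ) : ℝ :=
  ∑' m : ℤ, if k ≤ m then psiR χ ((2 : ℝ) ^ (-m) * s) else 0

/-- Littlewood–Paley projection `P_j`. -/
def proj {n : ℕ} (χ : ℝ → ℝ) (j : ℤ) (f : Eucl n → ℂ) : Eucl n → ℂ :=
  mulOp (fun ξ => (psiR χ ((2 : ℝ) ^ (-j) * ‖ξ‖) : ℂ)) f

/-- Low-frequency projection `P_{≤0} = I - Σ_{j≥1} P_j`. -/
def lowProj {n : ℕ} (χ : ℝ → ℝ) (f : Eucl n → ℂ) : Eucl n → ℂ :=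
  mulOp (fun ξ => ((1 - psiGe χ 1 ‖ξ‖ : ℝ) : ℂ)) f

/-- Directional frequency cutoff `Q^{e}_{j,l}` with symbol `ψ_{≥ j-l}(ξ·e)`. -/
def qproj {n : ℕ} (χ : ℝ → ℝ) (e : Eucl n) (j l : ℤ) (f : Eucl n → ℂ) : Eucl n → ℂ :=
  mulOp (fun ξ => ((psiGe χ (j - l) (inner ℝ ξ e : ℝ) : ℝ) : ℂ)) f

/-- `P_j` acting in the space variable of a space-time function. -/
def projT {n : ℕ} (χ : ℝ → ℝ) (j : ℤ) (u : ℝ × Eucl n → ℂ) : ℝ × Eucl n → ℂ :=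
  fun p => proj χ j (fun y => u (p.1, y)) p.2

/-- `P_{≤0}` acting in the space variable of a space-time function. -/
def lowProjT {n : ℕ} (χ : ℝ → ℝ) (u : ℝ × Eucl n → ℂ) : ℝ × Eucl n → ℂ :=
  fun p => lowProj χ (fun y => u (p.1, y)) p.2

/-- `Q^{e}_{j,l}` acting in the space variable of a space-time function. -/
def qprojT {n : ℕ} (χ : ℝ → ℝ) (e : Eucl n) (j l : ℤ) (u : ℝ × Eucl n → ℂ) :
    ℝ × Eucl n → ℂ :=
  fun p => qproj χ e j l (fun y => u (p.1, y)) p.2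

/-- The hyperplane `P_e = {ξ : ξ·e = 0}`. -/
def hyperplane {n : ℕ} (e : Eucl n) : Submodule ℝ (Eucl n) := (ℝ ∙ e)ᗮ

/-- Inner part of the anisotropic norm: the `L^q` norm over `P_e × ℝ` of
`(t,v) ↦ u(t, re + v)`. -/
def innerQ {n : ℕ} (q : ℝ≥0∞) (e : Eucl n) (u : ℝ × Eucl n → ℂ) (r : ℝ) : ℝ≥0∞ :=
  eLpNorm (fun tv : ℝ × (hyperplane e) => u (tv.1, r • e + (tv.2 : Eucl n))) q volume

/-- The anisotropic norm `‖u‖_{L^{p,q}_e}`. -/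
def aniNorm {n : ℕ} (p q : ℝ≥0∞) (e : Eucl n) (u : ℝ × Eucl n → ℂ) : ℝ≥0∞ :=
  if p = ∞ then essSup (innerQ q e u) volume
  else (∫⁻ r : ℝ, innerQ q e u r ^ p.toReal) ^ (1 / p.toReal)

/-- The mixed space-time norm `‖u‖_{L^q_t L^r_x}`. -/
def mixNorm {n : ℕ} (q r : ℝ≥0∞) (u : ℝ × Eucl n → ℂ) : ℝ≥0∞ :=
  if q = ∞ then essSup (fun t => eLpNorm (fun x => u (t, x)) r volume) volume
  else (∫⁻ t : ℝ, eLpNorm (fun x => u (t, x)) r volume ^ q.toReal) ^ (1 / q.toReal)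

/-- `2^a` as an extended nonnegative real. -/
def tp (a : ℝ) : ℝ≥0∞ := ENNReal.ofReal ((2 : ℝ) ^ a)

/-- Homogeneous Besov norm `‖φ‖_{Ḃ^s_{2,1}}`. -/
def homBesov {n : ℕ} (χ : ℝ → ℝ) (s : ℝ) (φ : Eucl n → ℂ) : ℝ≥0∞ :=
  ∑' j : ℤ, tp (s * j) * eLpNorm (proj χ j φ) 2 volume

/-- Inhomogeneous Besov norm `‖φ‖_{B^s_{2,1}}`. -/
def besov {n : ℕ} (χ : ℝ → ℝ) (s : ℝ) (φ : Eucl n → ℂ) : ℝ≥0∞ :=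
  eLpNorm (lowProj χ φ) 2 volume
    + ∑' j : ℕ, tp (s * (j + 1)) * eLpNorm (proj χ (j + 1) φ) 2 volume

/-- The supremum over unit vectors, auxiliary notation. -/
def sphSup {n : ℕ} (g : Eucl n → ℝ≥0∞) : ℝ≥0∞ := ⨆ (e : Eucl n) (_ : ‖e‖ = 1), g e

/-- `‖P_j u‖_{M^m_j} = 2^{-(n/2-1/(m-1))j} sup_e ‖P_j u‖_{L^{m-1,∞}_e}`. -/
def MmJ {n : ℕ} (χ : ℝ → ℝ) (m : ℕ) (j : ℤ) (u : ℝ × Eucl n → ℂ) : ℝ≥0∞ :=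
  tp (-((n : ℝ) / 2 - 1 / ((m : ℝ) - 1)) * j)
    * sphSup (fun e => aniNorm ((m : ℝ≥0∞) - 1) ∞ e (projT χ j u))

/-- `‖P_j u‖_{S_j} = 2^{j/2} sup_e ‖P_j Q^{e_±}_{j,20} u‖_{L^{∞,2}_e}`. -/
def SJ {n : ℕ} (ε : Fin n → ℝ) (χ : ℝ → ℝ) (j : ℤ) (u : ℝ × Eucl n → ℂ) : ℝ≥0∞ :=
  tp ((j : ℝ) / 2)
    * sphSup (fun e => aniNorm ∞ 2 e (projT χ j (qprojT χ (epm ε e) j 20 u)))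

/-- `‖P_j u‖_{T_j} = ‖P_j u‖_{L^∞_t L²_x}`. -/
def TJ {n : ℕ} (χ : ℝ → ℝ) (j : ℤ) (u : ℝ × Eucl n → ℂ) : ℝ≥0∞ :=
  mixNorm ∞ 2 (projT χ j u)

/-- `‖P_j u‖_{Y^m_j}`. -/
def YmJ {n : ℕ} (ε : Fin n → ℝ) (χ : ℝ → ℝ) (m : ℕ) (j : ℤ) (u : ℝ × Eucl n → ℂ) : ℝ≥0∞ :=
  MmJ χ m j u + SJ ε χ j u + TJ χ j u

/-- The homogeneous resolution norm `‖u‖_{Ż^σ_{2,1}}`. -/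
def Zhom {n : ℕ} (ε : Fin n → ℝ) (χ : ℝ → ℝ) (m : ℕ) (σ : ℝ) (u : ℝ × Eucl n → ℂ) : ℝ≥0∞ :=
  ∑' j : ℤ, tp (σ * j) * YmJ ε χ m j u

/-- `N_j`-norm of a function: `2^{-j/2} sup_e ‖f‖_{L^{1,2}_e}`. -/
def NJraw {n : ℕ} (j : ℤ) (f : ℝ × Eucl n → ℂ) : ℝ≥0∞ :=
  tp (-(j : ℝ) / 2) * sphSup (fun e => aniNorm 1 2 e f)

/-- `‖P_j u‖_{N_j}`. -/
def NJ {n : ℕ} (χ : ℝ → ℝ) (j : ℤ) (u : ℝ × Eucl n → ℂ) : ℝ≥0∞ :=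
  NJraw j (projT χ j u)

/-- The homogeneous nonlinear norm `‖F‖_{Ṅ^σ_{2,1}}`. -/
def Nhom {n : ℕ} (χ : ℝ → ℝ) (σ : ℝ) (F : ℝ × Eucl n → ℂ) : ℝ≥0∞ :=
  ∑' j : ℤ, tp (σ * j) * NJ χ j F

/-- `‖P_j u‖_{T̃_j} = ‖P_j u‖_{L^∞_t L²_x} + ‖P_j u‖_{L^{2+4/n}_{t,x}}`. -/
def TtilJ {n : ℕ} (χ : ℝ → ℝ) (j : ℤ) (u : ℝ × Eucl n → ℂ) : ℝ≥0∞ :=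
  mixNorm ∞ 2 (projT χ j u)
    + eLpNorm (projT χ j u) (ENNReal.ofReal (2 + 4 / (n : ℝ))) volume

/-- `‖P_j u‖_{M̃_j} = sup_{p ∈ ℤ, p ≥ 2, np ≥ 6} sup_e 2^{(n/2-1/p)j}‖P_j u‖_{L^{p,∞}_e}`. -/
def MtilJ {n : ℕ} (χ : ℝ → ℝ) (j : ℤ) (u : ℝ × Eucl n → ℂ) : ℝ≥0∞ :=
  ⨆ (p : ℕ) (_ : 2 ≤ p ∧ 6 ≤ n * p),
    sphSup (fun e => tp (((n : ℝ) / 2 - 1 / (p : ℝ)) * j) * aniNorm (p : ℝ≥0∞) ∞ e (projT χ j u))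

/-- `‖P_j u‖_{Ỹ_j}`. -/
def YtilJ {n : ℕ} (ε : Fin n → ℝ) (χ : ℝ → ℝ) (j : ℤ) (u : ℝ × Eucl n → ℂ) : ℝ≥0∞ :=
  MtilJ χ j u + SJ ε χ j u + TtilJ χ j u

/-- The inhomogeneous resolution norm `‖u‖_{Z̃^σ_{2,1}}`. -/
def Ztil {n : ℕ} (ε : Fin n → ℝ) (χ : ℝ → ℝ) (σ : ℝ) (u : ℝ × Eucl n → ℂ) : ℝ≥0∞ :=
  (∑' j : ℤ, if j ≤ 0 then YtilJ ε χ j u ^ 2 else 0) ^ ((1 : ℝ) / 2)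
    + ∑' j : ℤ, if 1 ≤ j then tp (σ * j) * YtilJ ε χ j u else 0

/-- `‖f‖_{Ñ_j}`: infimum over decompositions `f = v + w`. -/
def NtilJraw {n : ℕ} (j : ℤ) (f : ℝ × Eucl n → ℂ) : ℝ≥0∞ :=
  ⨅ (vw : (ℝ × Eucl n → ℂ) × (ℝ × Eucl n → ℂ)) (_ : f = vw.1 + vw.2),
    NJraw j vw.1 + eLpNorm vw.2 (ENNReal.ofReal ((2 * (n : ℝ) + 4) / ((n : ℝ) + 4))) volume

/-- The inhomogeneous nonlinear norm `‖F‖_{Ñ^σ_{2,1}}`. -/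
def Ntil {n : ℕ} (χ : ℝ → ℝ) (σ : ℝ) (F : ℝ × Eucl n → ℂ) : ℝ≥0∞ :=
  (∑' j : ℤ, if j ≤ 0 then NtilJraw j (projT χ j F) ^ 2 else 0) ^ ((1 : ℝ) / 2)
    + ∑' j : ℤ, if 1 ≤ j then tp (σ * j) * NtilJraw j (projT χ j F) else 0

/-- `k`-th spatial partial derivative of a space-time function. -/
def pd {n : ℕ} (k : ℕ) (u : ℝ × Eucl n → ℂ) (p : ℝ × Eucl n) : ℂ :=
  if h : k < n then fderiv ℝ (fun y => u (p.1, y)) p.2 (EuclideanSpace.single ⟨k, h⟩ (1 : ℝ))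
  else 0

/-- The retarded Duhamel integral `∫_0^t W_±(t-s) G(s) ds`. -/
def duhamel {n : ℕ} (ε : Fin n → ℝ) (G : ℝ × Eucl n → ℂ) (p : ℝ × Eucl n) : ℂ :=
  ∫ s in (0 : ℝ)..p.1, prop ε (p.1 - s) (fun y => G (s, y)) p.2

/-- Admissible Strichartz pair: `2/q = n(1/2 - 1/r)`, `q, r ≥ 2`, and `q ≠ 2` when `n = 2`. -/
def Admissible (n : ℕ) (q r : ℝ) : Prop :=
  2 / q = (n : ℝ) * (1 / 2 - 1 / r) ∧ 2 ≤ q ∧ 2 ≤ r ∧ (n = 2 → q ≠ 2)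

/-- Value of a power series with coefficients `c` at `z`. -/
def polyVal {d : ℕ} (c : (Fin d →₀ ℕ) → ℂ) (z : Fin d → ℂ) : ℂ :=
  ∑' β : Fin d →₀ ℕ, c β * ∏ i, z i ^ β i

/-- The argument vector `(u, ū, ∇u, ∇ū)` of the general nonlinearity. -/
def nlArg {n : ℕ} (u : ℝ × Eucl n → ℂ) (p : ℝ × Eucl n) (i : Fin (2 * n + 2)) : ℂ :=
  if (i : ℕ) = 0 then u p
  else if (i : ℕ) = 1 then starRingEnd ℂ (u p)
  else if (i : ℕ) < n + 2 then pd ((i : ℕ) - 2) u p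
  else pd ((i : ℕ) - (n + 2)) (fun q => starRingEnd ℂ (u q)) p

/-- The argument vector `(∇u, ∇ū)` of a nonlinearity in `2n` variables. -/
def gradArg {n : ℕ} (u : ℝ × Eucl n → ℂ) (p : ℝ × Eucl n) (i : Fin (2 * n)) : ℂ :=
  if (i : ℕ) < n then pd (i : ℕ) u p
  else pd ((i : ℕ) - n) (fun q => starRingEnd ℂ (u q)) p

end DNLS
open DNLS

open scoped SchwartzMap in
/-- Plancherel for `L¹ ∩ L²`. -/
theorem fourier_toLp_ae_eq {V : Type*} [NormedAddCommGroup V] [InnerProductSpace ℝ V]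
    [FiniteDimensional ℝ V] [MeasurableSpace V] [BorelSpace V] {f : V → ℂ}
    (hf : Integrable f) (hf2 : MemLp f 2) :
    ⇑(𝓕 (hf2.toLp f) : Lp ℂ 2 (volume : Measure V)) =ᵐ[volume] 𝓕 f := by
  have hcont : Continuous (𝓕 f) :=
    VectorFourier.fourierIntegral_continuous Real.continuous_fourierChar
      (by exact continuous_inner) hf
  refine ae_eq_of_integral_contDiff_smul_eq
    ((Lp.memLp _).locallyIntegrable (by norm_num)) hcont.locallyIntegrable fun g hg hgc => ?_
  set s : 𝓢(V, ℂ) := HasCompactSupport.toSchwartzMap (f := fun x => (g x : ℂ))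
    (hgc.comp_left (g := fun x : ℝ => (x : ℂ)) (by simp)) (Complex.ofRealCLM.contDiff.comp hg) with hs
  have h1 : ∀ x, s x = (g x : ℂ) := fun x => rfl
  have key := congrArg (fun T => T s) (Lp.fourier_toTemperedDistribution_eq (hf2.toLp f))
  simp only [TemperedDistribution.fourier_apply, Lp.toTemperedDistribution_apply] at key
  have h2 : ∫ x, (𝓕 s) x • (hf2.toLp f) x = ∫ x, (𝓕 (s : V → ℂ)) x • f x := by
    refine integral_congr_ae ?_
    filter_upwards [hf2.coeFn_toLp] with x hx
    rw [hx, SchwartzMap.fourier_coe]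
  have h3 : ∫ ξ, 𝓕 (s : V → ℂ) ξ • f ξ = ∫ x, (s : V → ℂ) x • 𝓕 f x := by
    have := VectorFourier.integral_fourierIntegral_smul_eq_flip (L := innerₗ V) (μ := volume) (ν := volume)
      (f := s) (g := f) Real.continuous_fourierChar (by exact continuous_inner) s.integrable hf
    rw [flip_innerₗ] at this
    exact this
  rw [h2, h3] at key
  simp only [h1, smul_eq_mul] at key
  simp only [Complex.real_smul]
  exact key.symm

theorem eLpNorm_fourier_eq {V : Type*} [NormedAddCommGroup V] [InnerProductSpace ℝ V]
    [FiniteDimensional ℝ V] [MeasurableSpace V] [BorelSpace V] {f : V → ℂ}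
    (hf : Integrable f) (hf2 : MemLp f 2) :
    eLpNorm (𝓕 f) 2 volume = eLpNorm f 2 volume := by
  rw [← eLpNorm_congr_ae (fourier_toLp_ae_eq hf hf2), ← Lp.enorm_def, ← Lp.enorm_toLp hf2, ← ofReal_norm,
    Lp.norm_fourier_eq, ofReal_norm]

/-- Quadratic form of Young / Schur type. -/
theorem lintegral_lintegral_mul_mul_le {α : Type*} [MeasurableSpace α] {μ : Measure α} [SFinite μ]
    {p : ℝ} (hp : 2 ≤ p) {H : α → ℝ≥0∞} (hH : Measurable H) {K : α → α → ℝ≥0∞}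
    (hK : Measurable (Function.uncurry K)) {D : ℝ≥0∞}
    (h₁ : ∀ r, ∫⁻ s, K r s ^ (p / 2) ∂μ ≤ D) (h₂ : ∀ s, ∫⁻ r, K r s ^ (p / 2) ∂μ ≤ D) :
    ∫⁻ r, ∫⁻ s, H r ^ (1 - 1 / p) * H s ^ (1 - 1 / p) * K r s ∂μ ∂μ
      ≤ (∫⁻ r, H r ∂μ) ^ (2 - 2 / p) * D ^ (2 / p) := by
  have hp0 : 0 < p := by linarith
  have h2p : 2 / p ≤ 1 := by rw [div_le_one hp0]; exact hp
  have h2p0 : 0 < 2 / p := by positivity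
  have m1 : Measurable fun z : α × α => H z.1 := hH.comp measurable_fst
  have m2 : Measurable fun z : α × α => H z.2 := hH.comp measurable_snd
  have mK : Measurable fun z : α × α => K z.1 z.2 := hK
  set I := ∫⁻ r, H r ∂μ with hI
  have e1 : ∀ r s, H r ^ (1 - 1 / p) * H s ^ (1 - 1 / p) * K r s
      = (H r * H s) ^ (1 - 2 / p)
        * ((H r * K r s ^ (p / 2)) ^ (1 / 2 : ℝ) * (H s * K r s ^ (p / 2)) ^ (1 / 2 : ℝ)) ^ (2 / p) := by
    intro r s
    have hsum : (1 - 1 / p) = (1 - 2 / p) + 1 / p := by ring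
    have h0 : (0 : ℝ) ≤ 1 - 2 / p := by linarith
    have h0' : (0 : ℝ) ≤ 1 / p := by positivity
    rw [hsum, ENNReal.rpow_add_of_nonneg _ _ h0 h0', ENNReal.rpow_add_of_nonneg _ _ h0 h0',
      ENNReal.mul_rpow_of_nonneg _ _ h0, ENNReal.mul_rpow_of_nonneg _ _ h2p0.le,
      ← ENNReal.rpow_mul, ← ENNReal.rpow_mul, show (1 / 2 : ℝ) * (2 / p) = 1 / p by ring,
      ENNReal.mul_rpow_of_nonneg _ _ h0', ENNReal.mul_rpow_of_nonneg _ _ h0', ← ENNReal.rpow_mul,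
      show p / 2 * (1 / p) = 1 / 2 by field_simp]
    have hk : K r s ^ (1 / 2 : ℝ) * K r s ^ (1 / 2 : ℝ) = K r s := by
      rw [← ENNReal.rpow_add_of_nonneg _ _ (by norm_num) (by norm_num)]; norm_num
    conv_lhs => rw [← hk]
    ring
  have c1 : ∫⁻ z : α × α, H z.1 * H z.2 ∂(μ.prod μ) = I * I := by
    rw [lintegral_prod_mul hH.aemeasurable hH.aemeasurable]
  have c2 : ∫⁻ z : α × α, H z.1 * K z.1 z.2 ^ (p / 2) ∂(μ.prod μ) ≤ I * D := by
    rw [lintegral_prod _ (by fun_prop), hI, ← lintegral_mul_const _ hH]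
    refine lintegral_mono fun r => ?_
    simp only
    rw [lintegral_const_mul _ (by exact (mK.comp measurable_prodMk_left).pow_const _)]
    gcongr
    exact h₁ r
  have c3 : ∫⁻ z : α × α, H z.2 * K z.1 z.2 ^ (p / 2) ∂(μ.prod μ) ≤ I * D := by
    rw [lintegral_prod_symm _ (by fun_prop), hI, ← lintegral_mul_const _ hH]
    refine lintegral_mono fun r => ?_
    simp only
    rw [lintegral_const_mul _ (by exact (mK.comp measurable_prodMk_right).pow_const _)]
    gcongr
    exact h₂ r
  calc ∫⁻ r, ∫⁻ s, H r ^ (1 - 1 / p) * H s ^ (1 - 1 / p) * K r s ∂μ ∂μ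
      = ∫⁻ z : α × α, (H z.1 * H z.2) ^ (1 - 2 / p)
        * ((H z.1 * K z.1 z.2 ^ (p / 2)) ^ (1 / 2 : ℝ)
          * (H z.2 * K z.1 z.2 ^ (p / 2)) ^ (1 / 2 : ℝ)) ^ (2 / p) ∂(μ.prod μ) := by
        rw [lintegral_prod _ (by fun_prop)]
        simp only [e1]
    _ ≤ (∫⁻ z : α × α, H z.1 * H z.2 ∂(μ.prod μ)) ^ (1 - 2 / p)
        * (∫⁻ z : α × α, (H z.1 * K z.1 z.2 ^ (p / 2)) ^ (1 / 2 : ℝ)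
          * (H z.2 * K z.1 z.2 ^ (p / 2)) ^ (1 / 2 : ℝ) ∂(μ.prod μ)) ^ (2 / p) :=
        ENNReal.lintegral_mul_norm_pow_le (by fun_prop) (by fun_prop) (by linarith) h2p0.le (by ring)
    _ ≤ (I * I) ^ (1 - 2 / p) * ((I * D) ^ (1 / 2 : ℝ) * (I * D) ^ (1 / 2 : ℝ)) ^ (2 / p) := by
        rw [c1]
        gcongr
        refine (ENNReal.lintegral_mul_norm_pow_le (by fun_prop) (by fun_prop) (by norm_num)
          (by norm_num) (by norm_num)).trans ?_
        gcongr
    _ = I ^ (2 - 2 / p) * D ^ (2 / p) := by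
        rw [← ENNReal.rpow_add_of_nonneg _ _ (by norm_num) (by norm_num)]
        norm_num
        rw [ENNReal.mul_rpow_of_nonneg _ _ (by linarith), ENNReal.mul_rpow_of_nonneg _ _ h2p0.le,
          ← ENNReal.rpow_add_of_nonneg _ _ (by linarith) (by linarith), ← mul_assoc,
          ← ENNReal.rpow_add_of_nonneg _ _ (by linarith) (by linarith)]
        congr 2
        ring

/-- The `TT*` argument. -/
theorem lintegral_enorm_inner_rpow_le {α : Type*} [MeasurableSpace α] {μ : Measure α}
    [IsFiniteMeasure μ] {E : Type*} [NormedAddCommGroup E] [InnerProductSpace ℂ E]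
    [CompleteSpace E] {p : ℝ} (hp : 2 ≤ p) {w : α → E} (hw : StronglyMeasurable w) {c : ℝ}
    (hc : ∀ r, ‖w r‖ ≤ c) {K : α → α → ℝ≥0∞} (hK : Measurable (Function.uncurry K)) {D : ℝ≥0∞}
    (hwK : ∀ r s, ‖inner ℂ (w r) (w s)‖ₑ ≤ K r s)
    (h₁ : ∀ r, ∫⁻ s, K r s ^ (p / 2) ∂μ ≤ D) (h₂ : ∀ s, ∫⁻ r, K r s ^ (p / 2) ∂μ ≤ D) (G : E) :
    ∫⁻ r, ‖inner ℂ G (w r)‖ₑ ^ p ∂μ ≤ ‖G‖ₑ ^ p * D := by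
  have hp0 : 0 < p := by linarith
  set f : α → ℂ := fun r => inner ℂ G (w r) with hf
  have hfm : StronglyMeasurable f := (continuous_const.inner continuous_id).comp_stronglyMeasurable hw
  have hfb : ∀ r, ‖f r‖ ≤ ‖G‖ * c := fun r =>
    (norm_inner_le_norm _ _).trans (by gcongr; exact hc r)
  set h : α → ℂ := fun r => ((‖f r‖ ^ (p - 2) : ℝ) : ℂ) * (starRingEnd ℂ) (f r) with hh
  have hhm : StronglyMeasurable h :=
    ((hfm.norm.measurable.pow_const _).complex_ofReal.mul
      (continuous_conj.measurable.comp hfm.measurable)).stronglyMeasurable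
  have hhn : ∀ r, ‖h r‖ = ‖f r‖ ^ (p - 1) := by
    intro r
    rw [hh]
    simp only [norm_mul, RCLike.norm_conj, norm_real, Real.norm_eq_abs]
    rw [abs_of_nonneg (by positivity)]
    rcases eq_or_ne (‖f r‖) 0 with h0 | h0
    · rw [h0, mul_zero, Real.zero_rpow (by linarith)]
    · conv_lhs => rw [← Real.rpow_one ‖f r‖]
      rw [← Real.rpow_mul (norm_nonneg _), ← Real.rpow_add (by positivity)]
      congr 1; ring
  have hhf : ∀ r, h r * f r = ((‖f r‖ ^ p : ℝ) : ℂ) := by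
    intro r
    rw [hh]
    simp only
    rw [mul_assoc, mul_comm ((starRingEnd ℂ) (f r)), mul_conj, normSq_eq_norm_sq, ← ofReal_mul]
    congr 1
    rcases eq_or_ne (‖f r‖) 0 with h0 | h0
    · rw [h0, Real.zero_rpow hp0.ne']; simp
    · rw [← Real.rpow_natCast, ← Real.rpow_add (by positivity)]
      congr 1; push_cast; ring
  have hhw : Integrable (fun r => h r • w r) μ := by
    refine Integrable.of_bound (hhm.smul hw).aestronglyMeasurable ((‖G‖ * c) ^ (p - 1) * c)
      (Eventually.of_forall fun r => ?_)
    rw [norm_smul, hhn]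
    have h0 := (norm_nonneg (f r)).trans (hfb r)
    exact mul_le_mul (Real.rpow_le_rpow (norm_nonneg _) (hfb r) (by linarith)) (hc r)
      (norm_nonneg _) (by positivity)
  set H : α → ℝ≥0∞ := fun r => ‖f r‖ₑ ^ p with hH
  have hHm : Measurable H := hfm.enorm.pow_const _
  have hhH : ∀ r, ‖h r‖ₑ = H r ^ (1 - 1 / p) := by
    intro r
    rw [hH, ← ofReal_norm, hhn, ← ENNReal.ofReal_rpow_of_nonneg (norm_nonneg _) (by linarith),
      ofReal_norm]
    simp only
    rw [← ENNReal.rpow_mul]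
    congr 1; field_simp
  set V : E := ∫ r, h r • w r ∂μ with hV
  set I := ∫⁻ r, H r ∂μ with hI
  have hHe : ∀ r, H r = ENNReal.ofReal (‖f r‖ ^ p) := by
    intro r
    rw [← ENNReal.ofReal_rpow_of_nonneg (norm_nonneg _) hp0.le, ofReal_norm]
  have hfin : I ≠ ∞ := by
    refine ((lintegral_mono (g := fun _ => ENNReal.ofReal ((‖G‖ * c) ^ p)) fun r => ?_).trans_lt ?_).ne
    · rw [hHe]
      exact ENNReal.ofReal_le_ofReal (Real.rpow_le_rpow (norm_nonneg _) (hfb r) hp0.le)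
    · rw [lintegral_const]
      exact ENNReal.mul_lt_top ENNReal.ofReal_lt_top (measure_lt_top _ _)
  have hGV : I ≤ ‖G‖ₑ * ‖V‖ₑ := by
    have e1 : inner ℂ G V = ((∫ r, ‖f r‖ ^ p ∂μ : ℝ) : ℂ) := by
      rw [hV, ← integral_inner hhw]
      refine Eq.trans ?_ (integral_ofReal (𝕜 := ℂ))
      refine integral_congr_ae (Eventually.of_forall fun r => ?_)
      simp only [inner_smul_right]
      exact hhf r
    have e2 : I = ‖inner ℂ G V‖ₑ := by
      rw [e1, ← ofReal_norm, norm_real, Real.norm_of_nonneg (integral_nonneg fun r => by positivity),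
        integral_eq_lintegral_of_nonneg_ae (Eventually.of_forall fun r => by positivity)
          (hfm.norm.measurable.pow_const _).aestronglyMeasurable]
      simp only [← hHe]
      rw [ENNReal.ofReal_toReal hfin]
    rw [e2, ← ofReal_norm, ← ofReal_norm, ← ofReal_norm, ← ENNReal.ofReal_mul (norm_nonneg _)]
    exact ENNReal.ofReal_le_ofReal (norm_inner_le_norm _ _)
  have hVV : ‖V‖ₑ ^ 2 ≤ I ^ (2 - 2 / p) * D ^ (2 / p) := by
    have e1 : ∀ x y : E, ‖inner ℂ x y‖ₑ = ‖inner ℂ y x‖ₑ := by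
      intro x y
      rw [← ofReal_norm, ← ofReal_norm, norm_inner_symm]
    have e2 : ∀ x : E, ‖inner ℂ x V‖ₑ ≤ ∫⁻ r, ‖h r‖ₑ * ‖inner ℂ x (w r)‖ₑ ∂μ := by
      intro x
      rw [hV, ← integral_inner hhw]
      refine (enorm_integral_le_lintegral_enorm _).trans (le_of_eq ?_)
      simp only [inner_smul_right, enorm_mul]
    calc ‖V‖ₑ ^ 2 = ‖inner ℂ V V‖ₑ := by
          rw [← ofReal_norm, ← ofReal_norm, inner_self_eq_norm_sq_to_K]
          rw [norm_pow, ← ENNReal.ofReal_pow (norm_nonneg _)]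
          simp
      _ ≤ ∫⁻ r, ‖h r‖ₑ * ‖inner ℂ V (w r)‖ₑ ∂μ := e2 V
      _ ≤ ∫⁻ r, ‖h r‖ₑ * ∫⁻ s, ‖h s‖ₑ * ‖inner ℂ (w r) (w s)‖ₑ ∂μ ∂μ := by
          gcongr with r
          rw [e1]
          exact e2 _
      _ ≤ ∫⁻ r, ∫⁻ s, H r ^ (1 - 1 / p) * H s ^ (1 - 1 / p) * K r s ∂μ ∂μ := by
          refine lintegral_mono fun r => ?_
          rw [← lintegral_const_mul' _ _ enorm_ne_top]
          refine lintegral_mono fun s => ?_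
          rw [← mul_assoc, hhH, hhH]
          gcongr
          exact hwK r s
      _ ≤ _ := lintegral_lintegral_mul_mul_le hp hHm hK h₁ h₂
  rcases eq_or_ne I 0 with h0 | h0
  · rw [h0]; exact zero_le
  have hI2 : I ^ (2 - 2 / p) * I ^ (2 / p) ≤ I ^ (2 - 2 / p) * (‖G‖ₑ ^ 2 * D ^ (2 / p)) := by
    calc I ^ (2 - 2 / p) * I ^ (2 / p) = I ^ 2 := by
          rw [← ENNReal.rpow_add _ _ h0 hfin]
          norm_num
      _ ≤ (‖G‖ₑ * ‖V‖ₑ) ^ 2 := by gcongr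
      _ ≤ ‖G‖ₑ ^ 2 * (I ^ (2 - 2 / p) * D ^ (2 / p)) := by
          rw [mul_pow]; gcongr
      _ = _ := by ring
  have hI3 := (ENNReal.mul_le_mul_iff_right (ENNReal.rpow_pos (pos_iff_ne_zero.2 h0) hfin).ne'
    (ENNReal.rpow_ne_top_of_nonneg (by
      have : 2 / p ≤ 1 := by rw [div_le_one hp0]; exact hp
      linarith) hfin)).1 hI2
  calc I = (I ^ (2 / p)) ^ (p / 2) := by
        rw [← ENNReal.rpow_mul]
        have : 2 / p * (p / 2) = 1 := by field_simp
        rw [this, ENNReal.rpow_one]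
    _ ≤ (‖G‖ₑ ^ 2 * D ^ (2 / p)) ^ (p / 2) := by gcongr
    _ = ‖G‖ₑ ^ p * D := by
        rw [ENNReal.mul_rpow_of_nonneg _ _ (by positivity), ← ENNReal.rpow_mul,
          ← ENNReal.rpow_natCast, ← ENNReal.rpow_mul]
        have : 2 / p * (p / 2) = 1 := by field_simp
        rw [this, ENNReal.rpow_one]
        congr 2
        push_cast; ring

/-- Passing from measurable selections to the supremum. -/
theorem lintegral_iSup_rpow_le {T α : Type*} [TopologicalSpace T] [TopologicalSpace.SeparableSpace T]
    [Nonempty T] [MeasurableSpace T] [MeasurableSpace α] {μ : Measure α} {p : ℝ} (hp : 0 < p)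
    {F : T → α → ℝ≥0∞} (hF : ∀ r, Continuous fun t => F t r)
    (hFm : Measurable (Function.uncurry F)) {B : ℝ≥0∞}
    (hB : ∀ τ : α → T, Measurable τ → ∫⁻ r, F (τ r) r ^ p ∂μ ≤ B) :
    ∫⁻ r, (⨆ t, F t r) ^ p ∂μ ≤ B := by
  set d := TopologicalSpace.denseSeq T
  have hsel : ∀ N : ℕ, ∃ τ : α → T, Measurable τ ∧
      ∀ r, F (τ r) r = (Finset.range (N + 1)).sup fun k => F (d k) r := by
    intro N
    induction N with
    | zero => exact ⟨fun _ => d 0, measurable_const, fun r => by simp⟩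
    | succ N ih =>
      obtain ⟨τ, hτ, h⟩ := ih
      have hm1 : Measurable fun r => F (τ r) r := hFm.comp (hτ.prodMk measurable_id)
      have hm2 : Measurable fun r => F (d (N + 1)) r := hFm.comp measurable_prodMk_left
      classical
      refine ⟨fun r => if F (τ r) r ≤ F (d (N + 1)) r then d (N + 1) else τ r,
        Measurable.ite (measurableSet_le hm1 hm2) measurable_const hτ, fun r => ?_⟩
      rw [Finset.range_add_one, Finset.sup_insert, ← h r]
      simp only
      split_ifs with hle
      · exact (sup_eq_left.2 hle).symm
      · exact (sup_eq_right.2 (not_le.1 hle).le).symm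
  choose τ hτ hτF using hsel
  have hmono : Monotone fun N r => F (τ N r) r ^ p := by
    refine monotone_nat_of_le_succ fun N r => ?_
    simp only [hτF]
    refine ENNReal.rpow_le_rpow ?_ hp.le
    exact Finset.sup_mono (f := fun k => F (d k) r)
      (Finset.range_mono (by omega : N + 1 ≤ N + 1 + 1))
  calc ∫⁻ r, (⨆ t, F t r) ^ p ∂μ ≤ ∫⁻ r, ⨆ N, F (τ N r) r ^ p ∂μ := by
        refine lintegral_mono fun r => ?_
        have hM : (⨆ N, F (τ N r) r ^ p) = (⨆ N, F (τ N r) r) ^ p :=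
          ((ENNReal.orderIsoRpow p hp).map_iSup _).symm
        rw [hM]
        gcongr
        refine iSup_le fun t => ?_
        have hcl : IsClosed {t | F t r ≤ ⨆ N, F (τ N r) r} := isClosed_le (hF r) continuous_const
        have hsub : Set.range d ⊆ {t | F t r ≤ ⨆ N, F (τ N r) r} := by
          rintro _ ⟨N, rfl⟩
          refine le_trans ?_ (le_iSup (fun N => F (τ N r) r) N)
          rw [hτF]
          exact Finset.le_sup (f := fun k => F (d k) r) (Finset.self_mem_range_succ N)
        exact hcl.closure_subset_iff.2 hsub (TopologicalSpace.denseRange_denseSeq T t)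
    _ = ⨆ N, ∫⁻ r, F (τ N r) r ^ p ∂μ :=
        lintegral_iSup (fun N => (hFm.comp ((hτ N).prodMk measurable_id)).pow_const _) hmono
    _ ≤ B := iSup_le fun N => hB _ (hτ N)

/-- Maximal form of the `TT*` argument, for a Gram kernel dominated by a convolution kernel. -/
theorem lintegral_iSup_enorm_inner_rpow_le {T : Type*} [TopologicalSpace T]
    [SecondCountableTopology T] [TopologicalSpace.PseudoMetrizableSpace T]
    [MeasurableSpace T] [BorelSpace T] [Nonempty T] {E : Type*} [NormedAddCommGroup E]
    [InnerProductSpace ℂ E] [CompleteSpace E] {p : ℝ} (hp : 2 ≤ p) {v : T × ℝ → E}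
    (hv : Continuous v) {c : ℝ} (hc : ∀ z, ‖v z‖ ≤ c) {k : ℝ → ℝ≥0∞} (hk : Measurable k)
    (hvk : ∀ t r t' r', ‖inner ℂ (v (t, r)) (v (t', r'))‖ₑ ≤ k (r - r')) (G : E) :
    ∫⁻ r : ℝ, (⨆ t, ‖inner ℂ G (v (t, r))‖ₑ) ^ p ≤ ‖G‖ₑ ^ p * ∫⁻ r, k r ^ (p / 2) := by
  have hF : Continuous fun z : T × ℝ => ‖inner ℂ G (v z)‖ₑ := (continuous_const.inner hv).enorm
  refine lintegral_iSup_rpow_le (F := fun t r => ‖inner ℂ G (v (t, r))‖ₑ) (by linarith)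
    (fun r => hF.comp (by fun_prop)) hF.measurable fun τ hτ => ?_
  have hcover : (⋃ N : ℕ, Set.Icc (-(N : ℝ)) N) = Set.univ := by
    refine Set.eq_univ_of_forall fun r => ?_
    obtain ⟨N, hN⟩ := exists_nat_ge |r|
    exact Set.mem_iUnion.2 ⟨N, abs_le.1 hN⟩
  have hdir : Directed (· ⊆ ·) fun N : ℕ => Set.Icc (-(N : ℝ)) N := by
    refine Monotone.directed_le fun M N h => ?_
    have : (M : ℝ) ≤ N := by exact_mod_cast h
    exact Set.Icc_subset_Icc (by linarith) this
  rw [← setLIntegral_univ, ← hcover, setLIntegral_iUnion_of_directed _ hdir]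
  refine iSup_le fun N => ?_
  have hw : StronglyMeasurable fun r => v (τ r, r) :=
    hv.comp_stronglyMeasurable (hτ.prodMk measurable_id).stronglyMeasurable
  refine lintegral_enorm_inner_rpow_le (μ := volume.restrict (Set.Icc (-(N : ℝ)) N))
    (K := fun r s => k (r - s)) hp hw (fun r => hc _)
    (hk.comp (measurable_fst.sub measurable_snd)) (fun r s => hvk _ _ _ _) (fun r => ?_)
    (fun s => ?_) G
  · refine (setLIntegral_le_lintegral _ _).trans (le_of_eq ?_)
    exact lintegral_sub_left_eq_self (fun x => k x ^ (p / 2)) r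
  · refine (setLIntegral_le_lintegral _ _).trans (le_of_eq ?_)
    exact lintegral_sub_right_eq_self (fun x => k x ^ (p / 2)) s

namespace DNLS

/-- Gaussian-damped plane wave adapted to the propagator. -/
def gaussWave {n : ℕ} (ε : Fin n → ℝ) (b : ℝ) (z : ℝ × Eucl n) (ξ : Eucl n) : ℂ :=
  cexp (((-(b * ‖ξ‖ ^ 2) : ℝ) : ℂ) + ((z.1 * quadSym ε ξ - 2 * Real.pi * inner ℝ ξ z.2 : ℝ) : ℂ) * I)

theorem continuous_quadSym {n : ℕ} (ε : Fin n → ℝ) : Continuous (quadSym ε) := by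
  unfold quadSym
  fun_prop

theorem continuous_gaussWave {n : ℕ} (ε : Fin n → ℝ) (b : ℝ) :
    Continuous (Function.uncurry (gaussWave ε b)) := by
  have := continuous_quadSym ε
  unfold gaussWave Function.uncurry
  fun_prop

theorem norm_gaussWave {n : ℕ} (ε : Fin n → ℝ) (b : ℝ) (z : ℝ × Eucl n) (ξ : Eucl n) :
    ‖gaussWave ε b z ξ‖ = Real.exp (-(b * ‖ξ‖ ^ 2)) := by
  rw [gaussWave, norm_exp, add_re, ofReal_re, re_ofReal_mul, I_re, mul_zero, add_zero]

theorem conj_gaussWave_mul {n : ℕ} (ε : Fin n → ℝ) (b : ℝ) (z z' : ℝ × Eucl n) (ξ : Eucl n) :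
    gaussWave ε b z' ξ * starRingEnd ℂ (gaussWave ε b z ξ) = gaussWave ε (2 * b) (z' - z) ξ := by
  simp only [gaussWave]
  rw [← exp_conj, ← Complex.exp_add]
  congr 1
  simp only [map_add, map_mul, conj_ofReal, conj_I, Prod.fst_sub, Prod.snd_sub, inner_sub_right]
  push_cast
  ring

theorem integrable_exp_neg_mul_norm_sq {n : ℕ} {b : ℝ} (hb : 0 < b) :
    Integrable fun ξ : Eucl n => Real.exp (-(b * ‖ξ‖ ^ 2)) := by
  have := (GaussianFourier.integrable_cexp_neg_mul_sq_norm_add (b := (b : ℂ)) (by simpa using hb) 0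
    (0 : Eucl n)).norm
  refine this.congr (Eventually.of_forall fun ξ => ?_)
  simp only [norm_exp]
  congr 1
  simp only [zero_mul, add_zero]
  norm_cast
  ring

theorem integrable_gaussWave {n : ℕ} (ε : Fin n → ℝ) {b : ℝ} (hb : 0 < b) (z : ℝ × Eucl n) :
    Integrable (gaussWave ε b z) := by
  refine (integrable_exp_neg_mul_norm_sq hb).mono'
    ((continuous_gaussWave ε b).comp (Continuous.prodMk_right z)).aestronglyMeasurable
    (Eventually.of_forall fun ξ => (norm_gaussWave ε b z ξ).le)

theorem continuous_integral_gaussWave {n : ℕ} (ε : Fin n → ℝ) {b : ℝ} (hb : 0 < b) :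
    Continuous fun z : ℝ × Eucl n => ∫ ξ, gaussWave ε b z ξ := by
  have h : ∀ ξ, Continuous fun z => gaussWave ε b z ξ := fun ξ => by
    unfold gaussWave
    fun_prop
  exact continuous_of_dominated (F := gaussWave ε b) (bound := fun ξ => Real.exp (-(b * ‖ξ‖ ^ 2)))
    (fun z => (integrable_gaussWave ε hb z).aestronglyMeasurable)
    (fun z => Eventually.of_forall fun ξ => (norm_gaussWave ε b z ξ).le)
    (integrable_exp_neg_mul_norm_sq hb) (Eventually.of_forall h)

theorem norm_integral_gaussWave {n : ℕ} {ε : Fin n → ℝ} (hε : ∀ i, ε i = 1 ∨ ε i = -1) {b : ℝ}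
    (hb : 0 < b) (t : ℝ) (x : Eucl n) :
    ‖∫ ξ, gaussWave ε b (t, x) ξ‖ = (Real.pi / √(b ^ 2 + t ^ 2)) ^ ((n : ℝ) / 2)
      * Real.exp (-(Real.pi ^ 2 * b * ‖x‖ ^ 2 / (b ^ 2 + t ^ 2))) := by
  have hS : 0 < b ^ 2 + t ^ 2 := by positivity
  have hε2 : ∀ i, ε i ^ 2 = 1 := fun i => by rcases hε i with h | h <;> simp [h]
  set β : Fin n → ℂ := fun i => (b : ℂ) - (t * ε i : ℝ) * I with hβ
  have hβre : ∀ i, (β i).re = b := fun i => by simp [hβ]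
  have hβim : ∀ i, (β i).im = -(t * ε i) := fun i => by simp [hβ]
  have hns : ∀ i, normSq (β i) = b ^ 2 + t ^ 2 := fun i => by
    rw [normSq_apply, hβre, hβim]
    linear_combination t ^ 2 * hε2 i
  have hint : ∫ ξ, gaussWave ε b (t, x) ξ = ∫ v : Fin n → ℝ,
      cexp (-∑ i, β i * (v i : ℂ) ^ 2 + ∑ i, (-(2 * Real.pi * x i : ℝ) * I) * v i) := by
    rw [← (PiLp.volume_preserving_toLp (Fin n)).integral_comp
      (MeasurableEquiv.toLp 2 _).measurableEmbedding]
    congr 1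
    ext v
    simp only [gaussWave, quadSym, EuclideanSpace.norm_sq_eq, PiLp.inner_apply, hβ]
    congr 1
    simp only [Real.norm_eq_abs, sq_abs, RCLike.inner_apply, conj_trivial]
    push_cast
    simp only [Finset.mul_sum, sub_mul, Finset.sum_mul, ← Finset.sum_neg_distrib,
      ← Finset.sum_add_distrib, ← Finset.sum_sub_distrib]
    refine Finset.sum_congr rfl fun i _ => ?_
    ring
  rw [hint, GaussianFourier.integral_cexp_neg_sum_mul_add (fun i => by rw [hβre]; exact hb), norm_prod]
  have hterm : ∀ i, ‖((Real.pi : ℂ) / β i) ^ (1 / 2 : ℂ)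
        * cexp ((-(2 * Real.pi * x i : ℝ) * I) ^ 2 / (4 * β i))‖
      = (Real.pi / √(b ^ 2 + t ^ 2)) ^ (1 / 2 : ℝ)
        * Real.exp (-(Real.pi ^ 2 * b / (b ^ 2 + t ^ 2)) * x i ^ 2) := by
    intro i
    rw [norm_mul]
    congr 1
    · rw [show (1 / 2 : ℂ) = ((1 / 2 : ℝ) : ℂ) by push_cast; rfl, norm_cpow_real, norm_div,
        norm_real, Real.norm_of_nonneg Real.pi_pos.le, Complex.norm_def, hns]
    · rw [norm_exp]
      congr 1
      have : (-(2 * Real.pi * x i : ℝ) * I) ^ 2 / (4 * β i)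
          = ((-(Real.pi ^ 2 * x i ^ 2) : ℝ) : ℂ) * (β i)⁻¹ := by
        rw [mul_pow, I_sq, div_eq_mul_inv, mul_inv]
        push_cast
        ring
      rw [this, re_ofReal_mul, inv_re, hβre, hns]
      field_simp
  rw [Finset.prod_congr rfl fun i _ => hterm i, Finset.prod_mul_distrib, ← Real.exp_sum,
    Finset.prod_const, ← Real.rpow_natCast, ← Real.rpow_mul (by positivity), ← Finset.mul_sum,
    EuclideanSpace.norm_sq_eq]
  simp only [Finset.card_univ, Fintype.card_fin, Real.norm_eq_abs, sq_abs]
  congr 2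
  · ring
  · ring

end DNLS

namespace DNLS

/-- Pointwise majorant of the dispersive kernel with Gaussian frequency cutoff. -/
def gaussDecay (n : ℕ) (b r : ℝ) : ℝ :=
  (n : ℝ) ^ ((n : ℝ) / 4) * (Real.pi / b) ^ ((n : ℝ) / 2) * (1 + r ^ 2 / b) ^ (-((n : ℝ) / 4))

theorem measurable_gaussDecay (n : ℕ) (b : ℝ) : Measurable (gaussDecay n b) := by
  unfold gaussDecay
  fun_prop

theorem gauss_le_gaussDecay {n : ℕ} (hn : 1 ≤ n) {b : ℝ} (hb : 0 < b) (t : ℝ) {r y : ℝ}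
    (hr : |r| ≤ y) :
    (Real.pi / √(b ^ 2 + t ^ 2)) ^ ((n : ℝ) / 2)
      * Real.exp (-(Real.pi ^ 2 * b * y ^ 2 / (b ^ 2 + t ^ 2))) ≤ gaussDecay n b r := by
  have hn' : (1 : ℝ) ≤ n := by exact_mod_cast hn
  have hn0 : (0 : ℝ) < n := by linarith
  set Y : ℝ := (b ^ 2 + t ^ 2) / b ^ 2 with hY
  have hY1 : 1 ≤ Y := by
    rw [hY, one_le_div (by positivity)]
    nlinarith [sq_nonneg t]
  have hY0 : 0 < Y := by linarith
  have hYb : b ^ 2 + t ^ 2 = b ^ 2 * Y := by rw [hY]; field_simp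
  set X : ℝ := r ^ 2 / b with hX
  have hX0 : 0 ≤ X := by positivity
  have h1 : (Real.pi / √(b ^ 2 + t ^ 2)) ^ ((n : ℝ) / 2)
      = (Real.pi / b) ^ ((n : ℝ) / 2) * Y ^ (-((n : ℝ) / 4)) := by
    rw [hYb, Real.sqrt_mul (by positivity), Real.sqrt_sq hb.le, div_mul_eq_div_div,
      Real.div_rpow (by positivity) (by positivity), Real.sqrt_eq_rpow, ← Real.rpow_mul hY0.le,
      Real.rpow_neg hY0.le, div_eq_mul_inv]
    congr 3
    ring
  have h2 : Real.exp (-(Real.pi ^ 2 * b * y ^ 2 / (b ^ 2 + t ^ 2))) ≤ Real.exp (-(X / Y)) := by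
    rw [Real.exp_le_exp, neg_le_neg_iff, hYb]
    have : X / Y = b * r ^ 2 / (b ^ 2 * Y) := by rw [hX]; field_simp
    rw [this]
    have hry : r ^ 2 ≤ y ^ 2 := by rw [← sq_abs r]; gcongr
    have hpi : 1 ≤ Real.pi ^ 2 := by nlinarith [Real.pi_gt_three]
    gcongr
    nlinarith [mul_nonneg hb.le (sq_nonneg y), mul_le_mul_of_nonneg_left hry hb.le]
  have h3 : Y ^ (-((n : ℝ) / 4)) * Real.exp (-(X / Y))
      ≤ (n : ℝ) ^ ((n : ℝ) / 4) * (1 + X) ^ (-((n : ℝ) / 4)) := by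
    have hz : 0 ≤ X / Y := by positivity
    have h4 : (1 + X) / Y ≤ n * Real.exp (X / Y / n) := by
      have h5 := Real.add_one_le_exp (X / Y / n)
      have h6 : n * (X / Y / n + 1) = X / Y + n := by field_simp
      have h7 : (1 + X) / Y ≤ 1 + X / Y := by
        rw [add_div]
        gcongr
        rw [div_le_one hY0]; exact hY1
      nlinarith [mul_le_mul_of_nonneg_left h5 hn0.le]
    have h8 : ((1 + X) / Y) ^ ((n : ℝ) / 4) ≤ (n : ℝ) ^ ((n : ℝ) / 4) * Real.exp (X / Y) := by
      refine (Real.rpow_le_rpow (by positivity) h4 (by positivity)).trans ?_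
      rw [Real.mul_rpow hn0.le (Real.exp_pos _).le, ← Real.exp_mul]
      gcongr
      have : X / Y / n * (n / 4) = X / Y / 4 := by field_simp
      rw [this]
      linarith
    rw [Real.div_rpow (by positivity) hY0.le] at h8
    rw [Real.rpow_neg hY0.le, Real.rpow_neg (by positivity), Real.exp_neg]
    have p1 : 0 < Y ^ ((n : ℝ) / 4) := by positivity
    have p2 : 0 < (1 + X) ^ ((n : ℝ) / 4) := by positivity
    rw [← mul_inv, ← div_eq_mul_inv, inv_le_comm₀ (by positivity) (by positivity), inv_div,
      div_le_iff₀ (by positivity)]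
    rw [div_le_iff₀ p1] at h8
    linarith
  rw [h1, gaussDecay]
  calc _ ≤ (Real.pi / b) ^ ((n : ℝ) / 2) * (Y ^ (-((n : ℝ) / 4)) * Real.exp (-(X / Y))) := by
        rw [mul_assoc]; gcongr
    _ ≤ (Real.pi / b) ^ ((n : ℝ) / 2)
          * ((n : ℝ) ^ ((n : ℝ) / 4) * (1 + X) ^ (-((n : ℝ) / 4))) := by gcongr
    _ = _ := by ring

theorem integrable_one_add_sq_rpow :
    Integrable fun r : ℝ => (1 + r ^ 2) ^ (-(3 / 4) : ℝ) := by
  have := integrable_rpow_neg_one_add_norm_sq (E := ℝ) (μ := volume) (r := 3 / 2) (by norm_num)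
  refine this.congr (Eventually.of_forall fun r => ?_)
  simp only [Real.norm_eq_abs, sq_abs]
  norm_num

/-- Constant in the bound for the norm of the kernel majorant. -/
def decayConst (n : ℕ) : ℝ :=
  ((n : ℝ) ^ ((n : ℝ) / 4) * Real.pi ^ ((n : ℝ) / 2)) ^ (1 / 2 : ℝ)
    * max 1 (∫ r : ℝ, (1 + r ^ 2) ^ (-(3 / 4) : ℝ))

theorem lintegral_gaussDecay_rpow_le {n : ℕ} {b p : ℝ} (hb : 0 < b) (hp : 2 ≤ p)
    (hnp : 6 ≤ (n : ℝ) * p) :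
    (∫⁻ r, ENNReal.ofReal (gaussDecay n b r) ^ (p / 2)) ^ (1 / p)
      ≤ ENNReal.ofReal (decayConst n * b ^ (-((n : ℝ) / 4) + 1 / (2 * p))) := by
  have hp0 : 0 < p := by linarith
  set A : ℝ := (n : ℝ) ^ ((n : ℝ) / 4) * Real.pi ^ ((n : ℝ) / 2) with hA
  have hA0 : 0 ≤ A := by positivity
  set D : ℝ := ∫ r : ℝ, (1 + r ^ 2) ^ (-(3 / 4) : ℝ) with hD
  have hD0 : 0 ≤ D := integral_nonneg fun r => by positivity
  set Q : ℝ := A * b ^ (-((n : ℝ) / 2)) with hQ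
  have hQ0 : 0 ≤ Q := by positivity
  have hint : Integrable fun r : ℝ => (1 + (r / √b) ^ 2) ^ (-(3 / 4) : ℝ) :=
    integrable_one_add_sq_rpow.comp_div (by positivity)
  have hpt : ∀ r, ENNReal.ofReal (gaussDecay n b r) ^ (p / 2)
      ≤ ENNReal.ofReal (Q ^ (p / 2) * (1 + (r / √b) ^ 2) ^ (-(3 / 4) : ℝ)) := by
    intro r
    have h0 : 0 ≤ gaussDecay n b r := by unfold gaussDecay; positivity
    rw [ENNReal.ofReal_rpow_of_nonneg h0 (by positivity)]
    refine ENNReal.ofReal_le_ofReal ?_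
    have e : gaussDecay n b r = Q * (1 + (r / √b) ^ 2) ^ (-((n : ℝ) / 4)) := by
      rw [gaussDecay, hQ, hA, Real.div_rpow Real.pi_pos.le hb.le, Real.rpow_neg hb.le, div_pow,
        Real.sq_sqrt hb.le]
      ring
    rw [e, Real.mul_rpow hQ0 (by positivity), ← Real.rpow_mul (by positivity)]
    gcongr
    · have : 0 ≤ (r / √b) ^ 2 := by positivity
      linarith
    · nlinarith
  have hI : ∫⁻ r, ENNReal.ofReal (gaussDecay n b r) ^ (p / 2)
      ≤ ENNReal.ofReal (Q ^ (p / 2) * (√b * D)) := by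
    refine (lintegral_mono hpt).trans (le_of_eq ?_)
    rw [← ofReal_integral_eq_lintegral_ofReal (hint.const_mul _)
      (Eventually.of_forall fun r => by positivity), integral_const_mul,
      Measure.integral_comp_div (fun r : ℝ => (1 + r ^ 2) ^ (-(3 / 4) : ℝ)) (√b),
      abs_of_nonneg (Real.sqrt_nonneg b), smul_eq_mul]
  refine (ENNReal.rpow_le_rpow hI (by positivity)).trans ?_
  rw [ENNReal.ofReal_rpow_of_nonneg (by positivity) (by positivity)]
  refine ENNReal.ofReal_le_ofReal ?_
  rw [Real.mul_rpow (by positivity) (by positivity), Real.mul_rpow (by positivity) hD0,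
    ← Real.rpow_mul hQ0, show p / 2 * (1 / p) = 1 / 2 by field_simp, hQ,
    Real.mul_rpow hA0 (by positivity), ← Real.rpow_mul hb.le, Real.sqrt_eq_rpow,
    ← Real.rpow_mul hb.le, decayConst, Real.rpow_add hb]
  have hDp : D ^ (1 / p) ≤ max 1 D := by
    rcases le_total D 1 with h | h
    · exact (Real.rpow_le_one hD0 h (by positivity)).trans (le_max_left _ _)
    · calc D ^ (1 / p) ≤ D ^ (1 : ℝ) :=
            Real.rpow_le_rpow_of_exponent_le h (by rw [div_le_one hp0]; linarith)
        _ = D := Real.rpow_one D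
        _ ≤ _ := le_max_right _ _
  calc _ = A ^ (1 / 2 : ℝ) * D ^ (1 / p) * (b ^ (-((n : ℝ) / 4)) * b ^ (1 / (2 * p))) := by
        rw [show -((n : ℝ) / 2) * (1 / 2) = -((n : ℝ) / 4) by ring,
          show 1 / 2 * (1 / p) = 1 / (2 * p) by field_simp]
        ring
    _ ≤ _ := by gcongr

end DNLS

namespace DNLS

theorem memLp_gaussWave {n : ℕ} (ε : Fin n → ℝ) {b : ℝ} (hb : 0 < b) (z : ℝ × Eucl n) :
    MemLp (gaussWave ε b z) 2 volume := by
  refine (memLp_two_iff_integrable_sq_norm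
    (integrable_gaussWave ε hb z).aestronglyMeasurable).2 ?_
  refine (integrable_exp_neg_mul_norm_sq (n := n) (b := 2 * b) (by positivity)).congr
    (Eventually.of_forall fun ξ => ?_)
  dsimp only
  rw [norm_gaussWave, ← Real.exp_nat_mul]
  congr 1
  push_cast
  ring

/-- The Gaussian-damped plane wave as an element of `L²`. -/
def gaussL2 {n : ℕ} (ε : Fin n → ℝ) {b : ℝ} (hb : 0 < b) (z : ℝ × Eucl n) :
    Lp ℂ 2 (volume : Measure (Eucl n)) :=
  (memLp_gaussWave ε hb z).toLp _

theorem inner_gaussL2 {n : ℕ} (ε : Fin n → ℝ) {b : ℝ} (hb : 0 < b) (z z' : ℝ × Eucl n) :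
    inner ℂ (gaussL2 ε hb z) (gaussL2 ε hb z') = ∫ ξ, gaussWave ε (2 * b) (z' - z) ξ := by
  rw [L2.inner_def]
  refine integral_congr_ae ?_
  filter_upwards [(memLp_gaussWave ε hb z).coeFn_toLp, (memLp_gaussWave ε hb z').coeFn_toLp]
    with ξ h h'
  rw [gaussL2, gaussL2, h, h', RCLike.inner_apply, conj_gaussWave_mul]

theorem norm_gaussL2 {n : ℕ} (ε : Fin n → ℝ) {b : ℝ} (hb : 0 < b) (z : ℝ × Eucl n) :
    ‖gaussL2 ε hb z‖ = √(RCLike.re (∫ ξ, gaussWave ε (2 * b) 0 ξ)) := by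
  rw [@norm_eq_sqrt_re_inner ℂ, inner_gaussL2, sub_self]

theorem continuous_gaussL2 {n : ℕ} (ε : Fin n → ℝ) {b : ℝ} (hb : 0 < b) :
    Continuous (gaussL2 ε hb) := by
  have hK := continuous_integral_gaussWave ε (b := 2 * b) (by positivity)
  rw [continuous_iff_continuousAt]
  intro z₀
  rw [ContinuousAt, tendsto_iff_norm_sub_tendsto_zero]
  have h : ∀ z, ‖gaussL2 ε hb z - gaussL2 ε hb z₀‖
      = √(‖gaussL2 ε hb z₀‖ ^ 2 - 2 * RCLike.re (∫ ξ, gaussWave ε (2 * b) (z₀ - z) ξ)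
        + ‖gaussL2 ε hb z₀‖ ^ 2) := fun z => by
    rw [← inner_gaussL2 ε hb z z₀, norm_gaussL2 ε hb z₀, ← norm_gaussL2 ε hb z]
    nth_rewrite 2 [norm_gaussL2 ε hb z]
    rw [← norm_gaussL2 ε hb z₀, ← @norm_sub_sq ℂ, Real.sqrt_sq (norm_nonneg _)]
  simp only [h]
  have h0 : (0 : ℝ) = √(‖gaussL2 ε hb z₀‖ ^ 2 - 2 * RCLike.re (∫ ξ, gaussWave ε (2 * b) (z₀ - z₀) ξ)
        + ‖gaussL2 ε hb z₀‖ ^ 2) := by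
    rw [← h, sub_self, norm_zero]
  rw [h0]
  refine Continuous.tendsto (f := fun z => √(‖gaussL2 ε hb z₀‖ ^ 2
    - 2 * RCLike.re (∫ ξ, gaussWave ε (2 * b) (z₀ - z) ξ) + ‖gaussL2 ε hb z₀‖ ^ 2)) ?_ z₀
  have : Continuous fun z => ∫ ξ, gaussWave ε (2 * b) (z₀ - z) ξ :=
    hK.comp (continuous_const.sub continuous_id)
  have := RCLike.continuous_re.comp this
  exact ((continuous_const.sub (continuous_const.mul this)).add continuous_const).sqrt

theorem abs_le_norm_smul_add {n : ℕ} {e : Eucl n} (he : ‖e‖ = 1) (r : ℝ) (y : hyperplane e) :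
    |r| ≤ ‖r • e + (y : Eucl n)‖ := by
  have hy : inner ℝ e (y : Eucl n) = 0 := Submodule.mem_orthogonal_singleton_iff_inner_right.1 y.2
  have h : inner ℝ e (r • e + (y : Eucl n)) = r := by
    rw [inner_add_right, inner_smul_right, hy, real_inner_self_eq_norm_sq, he]
    ring
  calc |r| = |inner ℝ e (r • e + (y : Eucl n))| := by rw [h]
    _ ≤ ‖e‖ * ‖r • e + (y : Eucl n)‖ := abs_real_inner_le_norm _ _
    _ = _ := by rw [he, one_mul]

theorem enorm_inner_gaussL2_le {n : ℕ} (hn : 1 ≤ n) {ε : Fin n → ℝ}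
    (hε : ∀ i, ε i = 1 ∨ ε i = -1) {b : ℝ} (hb : 0 < b) {e : Eucl n} (he : ‖e‖ = 1)
    (t r t' r' : ℝ) (y y' : hyperplane e) :
    ‖inner ℂ (gaussL2 ε hb (t, r • e + (y : Eucl n))) (gaussL2 ε hb (t', r' • e + (y' : Eucl n)))‖ₑ
      ≤ ENNReal.ofReal (gaussDecay n (2 * b) (r - r')) := by
  rw [inner_gaussL2, ← ofReal_norm]
  refine ENNReal.ofReal_le_ofReal ?_
  rw [Prod.mk_sub_mk, norm_integral_gaussWave hε (by positivity)]
  refine gauss_le_gaussDecay hn (by positivity) _ ?_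
  have : r' • e + (y' : Eucl n) - (r • e + (y : Eucl n)) = (r' - r) • e + ((y' - y : hyperplane e) : Eucl n) := by
    rw [Submodule.coe_sub, sub_smul]
    abel
  rw [this, abs_sub_comm]
  exact abs_le_norm_smul_add he _ _

/-- Maximal function estimate for the Gaussian-damped evolution. -/
theorem lintegral_iSup_enorm_inner_gaussL2_le {n : ℕ} (hn : 1 ≤ n) {ε : Fin n → ℝ}
    (hε : ∀ i, ε i = 1 ∨ ε i = -1) {b : ℝ} (hb : 0 < b) {e : Eucl n} (he : ‖e‖ = 1) {p : ℝ}
    (hp : 2 ≤ p) (hnp : 6 ≤ (n : ℝ) * p) (G : Lp ℂ 2 (volume : Measure (Eucl n))) :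
    (∫⁻ r : ℝ, (⨆ z : ℝ × hyperplane e,
        ‖inner ℂ G (gaussL2 ε hb (z.1, r • e + (z.2 : Eucl n)))‖ₑ) ^ p) ^ (1 / p)
      ≤ ‖G‖ₑ * ENNReal.ofReal (decayConst n * (2 * b) ^ (-((n : ℝ) / 4) + 1 / (2 * p))) := by
  have hp0 : 0 < p := by linarith
  have key := lintegral_iSup_enorm_inner_rpow_le hp
    (v := fun z : (ℝ × hyperplane e) × ℝ => gaussL2 ε hb (z.1.1, z.2 • e + (z.1.2 : Eucl n)))
    ((continuous_gaussL2 ε hb).comp (by fun_prop)) (fun z => (norm_gaussL2 ε hb _).le)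
    (k := fun r => ENNReal.ofReal (gaussDecay n (2 * b) r))
    (measurable_gaussDecay n (2 * b)).ennreal_ofReal
    (fun t r t' r' => enorm_inner_gaussL2_le hn hε hb he t.1 r t'.1 r' t.2 t'.2) G
  refine (ENNReal.rpow_le_rpow key (by positivity)).trans ?_
  rw [ENNReal.mul_rpow_of_nonneg _ _ (by positivity), ← ENNReal.rpow_mul,
    mul_one_div_cancel hp0.ne', ENNReal.rpow_one]
  gcongr
  exact lintegral_gaussDecay_rpow_le (by positivity) hp hnp

end DNLS

theorem fourier_eq_zero_of_not_integrable {V : Type*} [NormedAddCommGroup V]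
    [InnerProductSpace ℝ V] [FiniteDimensional ℝ V] [MeasurableSpace V] [BorelSpace V] {f : V → ℂ}
    (hf : ¬ Integrable f) : 𝓕 f = 0 := by
  ext w
  rw [Real.fourier_eq]
  exact integral_undef (by rwa [Real.fourierIntegral_convergent_iff])

theorem fourierInv_eq_zero_of_not_integrable {V : Type*} [NormedAddCommGroup V]
    [InnerProductSpace ℝ V] [FiniteDimensional ℝ V] [MeasurableSpace V] [BorelSpace V] {f : V → ℂ}
    (hf : ¬ Integrable f) : 𝓕⁻ f = 0 := by
  ext w
  rw [Real.fourierInv_eq_fourier_neg, fourier_eq_zero_of_not_integrable hf]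
  rfl

namespace DNLS

theorem mulOp_mulOp_eq_zero_or {n : ℕ} {m₁ m₂ : Eucl n → ℂ} (hm : Continuous m₁)
    (f : Eucl n → ℂ) :
    mulOp m₂ (mulOp m₁ f) = 0 ∨
      Integrable f ∧ mulOp m₂ (mulOp m₁ f) = 𝓕⁻ fun ξ => m₂ ξ * (m₁ ξ * 𝓕 f ξ) := by
  have h0 : 𝓕⁻ (fun _ : Eucl n => (0 : ℂ)) = 0 := by
    ext w
    simp [Real.fourierInv_eq]
  by_cases hi : Integrable (𝓕⁻ fun ξ => m₁ ξ * 𝓕 f ξ)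
  swap
  · left
    simp only [mulOp, fourier_eq_zero_of_not_integrable hi, Pi.zero_apply, mul_zero, h0]
  by_cases hg : Integrable fun ξ => m₁ ξ * 𝓕 f ξ
  swap
  · left
    simp only [mulOp, fourierInv_eq_zero_of_not_integrable hg]
    rw [show 𝓕 (0 : Eucl n → ℂ) = 0 by ext w; simp [Real.fourier_eq]]
    simp [h0]
  by_cases hf : Integrable f
  swap
  · left
    simp only [mulOp, fourier_eq_zero_of_not_integrable hf, Pi.zero_apply, mul_zero, h0]
    rw [show 𝓕 (0 : Eucl n → ℂ) = 0 by ext w; simp [Real.fourier_eq]]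
    simp [h0]
  right
  refine ⟨hf, ?_⟩
  have hcont : Continuous (𝓕 f) :=
    VectorFourier.fourierIntegral_continuous Real.continuous_fourierChar
      (by exact continuous_inner) hf
  have hi' : Integrable (𝓕 fun ξ => m₁ ξ * 𝓕 f ξ) := by
    refine hi.comp_neg.congr (Eventually.of_forall fun ξ => ?_)
    simp only [Real.fourierInv_eq_fourier_neg, neg_neg]
  have hinv : 𝓕 (𝓕⁻ fun ξ => m₁ ξ * 𝓕 f ξ) = fun ξ => m₁ ξ * 𝓕 f ξ :=
    (hm.mul hcont).fourier_fourierInv_eq hg hi'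
  simp only [mulOp, hinv]

theorem IsBump.exists_abs_psiR_le {χ : ℝ → ℝ} (hχ : IsBump χ) : ∃ M, 0 < M ∧ ∀ s, |psiR χ s| ≤ M := by
  have hc : Continuous χ := (hχ.smooth 0).continuous
  obtain ⟨M, hM⟩ := (isCompact_Icc (a := (-2 : ℝ)) (b := 2)).exists_bound_of_continuousOn
    hc.continuousOn
  have hM' : ∀ s, |χ s| ≤ |M| := fun s => by
    by_cases hs : |s| ≤ 2
    · exact (hM s (abs_le.1 hs)).trans (le_abs_self M)
    · rw [hχ.supp s (not_le.1 hs).le, abs_zero]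
      exact abs_nonneg M
  refine ⟨2 * |M| + 1, by positivity, fun s => ?_⟩
  have := abs_sub (χ |s|) (χ (2 * |s|))
  rw [psiR]
  linarith [hM' |s|, hM' (2 * |s|)]

theorem IsBump.psiR_eq_zero {χ : ℝ → ℝ} (hχ : IsBump χ) {s : ℝ} (hs : 2 ≤ |s|) : psiR χ s = 0 := by
  rw [psiR, hχ.supp _ (by rwa [abs_abs]), hχ.supp _ (by rw [abs_mul, abs_abs, abs_two]; linarith),
    sub_zero]

theorem IsBump.continuous_psiR {χ : ℝ → ℝ} (hχ : IsBump χ) : Continuous (psiR χ) := by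
  have hc : Continuous χ := (hχ.smooth 0).continuous
  unfold psiR
  fun_prop

/-- The frequency profile paired with the Gaussian-damped plane waves. -/
def profile {n : ℕ} (χ : ℝ → ℝ) (j : ℤ) (b : ℝ) (φ : Eucl n → ℂ) (ξ : Eucl n) : ℂ :=
  ((psiR χ ((2 : ℝ) ^ (-j) * ‖ξ‖) * Real.exp (b * ‖ξ‖ ^ 2) : ℝ) : ℂ) * 𝓕 φ ξ

theorem norm_profile_le {n : ℕ} {χ : ℝ → ℝ} (hχ : IsBump χ) {M : ℝ} (hM : ∀ s, |psiR χ s| ≤ M)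
    (j : ℤ) (φ : Eucl n → ℂ) (ξ : Eucl n) :
    ‖profile χ j (((2 : ℝ) ^ (-j)) ^ 2 / 2) φ ξ‖ ≤ M * Real.exp 2 * ‖𝓕 φ ξ‖ := by
  have hM0 : 0 ≤ M := (abs_nonneg _).trans (hM 0)
  rw [profile, norm_mul, norm_real, norm_mul, Real.norm_eq_abs, Real.norm_of_nonneg (Real.exp_nonneg _)]
  refine mul_le_mul_of_nonneg_right ?_ (norm_nonneg _)
  set s := (2 : ℝ) ^ (-j) * ‖ξ‖ with hs
  have hs0 : 0 ≤ s := by positivity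
  by_cases h : 2 ≤ |s|
  · rw [hχ.psiR_eq_zero h, abs_zero, zero_mul]
    positivity
  · refine mul_le_mul (hM _) (Real.exp_le_exp.2 ?_) (Real.exp_nonneg _) hM0
    rw [abs_of_nonneg hs0] at h
    have : ((2 : ℝ) ^ (-j)) ^ 2 / 2 * ‖ξ‖ ^ 2 = s ^ 2 / 2 := by rw [hs]; ring
    rw [this]
    nlinarith

theorem memLp_profile {n : ℕ} {χ : ℝ → ℝ} (hχ : IsBump χ) (j : ℤ) {φ : Eucl n → ℂ}
    (hφ : Integrable φ) (hφ2 : MemLp φ 2 volume) :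
    MemLp (profile χ j (((2 : ℝ) ^ (-j)) ^ 2 / 2) φ) 2 volume := by
  obtain ⟨M, -, hM⟩ := hχ.exists_abs_psiR_le
  have hcont : Continuous (𝓕 φ) :=
    VectorFourier.fourierIntegral_continuous Real.continuous_fourierChar
      (by exact continuous_inner) hφ
  have hψ := hχ.continuous_psiR
  have h2 : MemLp (𝓕 φ) 2 volume := ⟨hcont.aestronglyMeasurable, by
    rw [eLpNorm_fourier_eq hφ hφ2]; exact hφ2.2⟩
  refine h2.of_le_mul (c := M * Real.exp 2) (Continuous.aestronglyMeasurable ?_)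
    (Eventually.of_forall fun ξ => norm_profile_le hχ hM j φ ξ)
  unfold profile
  fun_prop

theorem enorm_profile_toLp_le {n : ℕ} {χ : ℝ → ℝ} (hχ : IsBump χ) {M : ℝ}
    (hM : ∀ s, |psiR χ s| ≤ M) (j : ℤ) {φ : Eucl n → ℂ} (hφ : Integrable φ)
    (hφ2 : MemLp φ 2 volume) :
    ‖(memLp_profile hχ j hφ hφ2).toLp _‖ₑ
      ≤ ENNReal.ofReal (M * Real.exp 2) * eLpNorm φ 2 volume := by
  rw [Lp.enorm_toLp, ← eLpNorm_fourier_eq hφ hφ2]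
  exact eLpNorm_le_mul_eLpNorm_of_ae_le_mul
    (Eventually.of_forall fun ξ => norm_profile_le hχ hM j φ ξ) 2

theorem fourierInv_eq_inner_gaussL2 {n : ℕ} {χ : ℝ → ℝ} (ε : Fin n → ℝ) (j : ℤ) {b : ℝ}
    (hb : 0 < b) {φ : Eucl n → ℂ} (hG : MemLp (profile χ j b φ) 2 volume) (t : ℝ) (x : Eucl n) :
    𝓕⁻ (fun ξ => (psiR χ ((2 : ℝ) ^ (-j) * ‖ξ‖) : ℂ) *
      (cexp (-I * t * quadSym ε ξ) * 𝓕 φ ξ)) x = inner ℂ (gaussL2 ε hb (t, x)) (hG.toLp _) := by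
  rw [L2.inner_def, Real.fourierInv_eq']
  refine integral_congr_ae ?_
  filter_upwards [(memLp_gaussWave ε hb (t, x)).coeFn_toLp, hG.coeFn_toLp] with ξ h h'
  rw [gaussL2, h, h', RCLike.inner_apply, profile, gaussWave, ← exp_conj, smul_eq_mul]
  have : cexp (((2 * Real.pi * inner ℝ ξ x : ℝ) : ℂ) * I) * cexp (-I * t * quadSym ε ξ)
      = Real.exp (b * ‖ξ‖ ^ 2) * cexp (starRingEnd ℂ (((-(b * ‖ξ‖ ^ 2) : ℝ) : ℂ)
        + ((t * quadSym ε ξ - 2 * Real.pi * inner ℝ ξ x : ℝ) : ℂ) * I)) := by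
    rw [ofReal_exp, ← Complex.exp_add, ← Complex.exp_add]
    congr 1
    simp only [map_add, map_mul, conj_ofReal, conj_I]
    push_cast
    ring
  push_cast at this ⊢
  linear_combination (psiR χ ((2 : ℝ) ^ (-j) * ‖ξ‖) : ℂ) * 𝓕 φ ξ * this

end DNLS

namespace DNLS

theorem continuous_propSymbol {n : ℕ} (ε : Fin n → ℝ) (t : ℝ) :
    Continuous fun ξ : Eucl n => cexp (-I * t * quadSym ε ξ) := by
  have := continuous_quadSym ε
  fun_prop

theorem decayConst_pos {n : ℕ} (hn : 1 ≤ n) : 0 < decayConst n := by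
  have : (0 : ℝ) < n := by exact_mod_cast hn
  have := Real.pi_pos
  have : (0 : ℝ) < max 1 (∫ r : ℝ, (1 + r ^ 2) ^ (-(3 / 4) : ℝ)) := lt_max_of_lt_left one_pos
  unfold decayConst
  positivity

end DNLS

/-- maximal function estimate
`2^{-(n/2-1/p)j}‖P_j W_±(t)φ‖_{L^{p,∞}_e} ≤ C‖φ‖_{L²}`. -/
theorem maximal_function_estimate
    (n : ℕ) (hn : 2 ≤ n) (ε : Fin n → ℝ) (hε : ∀ i, ε i = 1 ∨ ε i = -1)
    (χ : ℝ → ℝ) (hχ : IsBump χ) :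
    ∃ C : ℝ, 0 < C ∧ ∀ (p : ℝ), 2 ≤ p → 6 ≤ (n : ℝ) * p →
      ∀ (j : ℤ) (e : Eucl n), ‖e‖ = 1 → ∀ φ : Eucl n → ℂ, MemLp φ 2 volume →
      tp (-(((n : ℝ) / 2 - 1 / p)) * j) *
        aniNorm (ENNReal.ofReal p) ∞ e
          (fun q : ℝ × Eucl n => proj χ j (prop ε q.1 φ) q.2)
      ≤ ENNReal.ofReal C * eLpNorm φ 2 volume := by
  obtain ⟨M, hM0, hM⟩ := hχ.exists_abs_psiR_le
  refine ⟨decayConst n * (M * Real.exp 2), mul_pos (decayConst_pos (by omega)) (by positivity), ?_⟩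
  intro p hp hnp j e he φ hφ
  have hp0 : 0 < p := by linarith
  have hb : 0 < ((2 : ℝ) ^ (-j)) ^ 2 / 2 := by positivity
  rw [aniNorm, if_neg ENNReal.ofReal_ne_top, ENNReal.toReal_ofReal hp0.le]
  by_cases hi : Integrable φ
  swap
  · have hz : ∀ t, proj χ j (prop ε t φ) = 0 := fun t =>
      (mulOp_mulOp_eq_zero_or (continuous_propSymbol ε t) φ).resolve_right fun h => hi h.1
    simp only [innerQ, hz, Pi.zero_apply, eLpNorm_zero']
    simp [ENNReal.zero_rpow_of_pos, hp0]
  set G := (memLp_profile hχ j hi hφ).toLp _ with hG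
  have hpt : ∀ (t : ℝ) (x : Eucl n), ‖proj χ j (prop ε t φ) x‖ₑ ≤ ‖inner ℂ G (gaussL2 ε hb (t, x))‖ₑ := by
    intro t x
    rcases mulOp_mulOp_eq_zero_or (m₂ := fun ξ => (psiR χ ((2 : ℝ) ^ (-j) * ‖ξ‖) : ℂ))
      (continuous_propSymbol ε t) φ with h | ⟨-, h⟩
    · rw [proj, prop, h]
      simp
    · rw [proj, prop, h, fourierInv_eq_inner_gaussL2 ε j hb (memLp_profile hχ j hi hφ), ← hG,
        ← ofReal_norm, ← ofReal_norm, norm_inner_symm]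
  have hmax : ∀ r, innerQ ∞ e (fun q : ℝ × Eucl n => proj χ j (prop ε q.1 φ) q.2) r
      ≤ ⨆ z : ℝ × hyperplane e, ‖inner ℂ G (gaussL2 ε hb (z.1, r • e + (z.2 : Eucl n)))‖ₑ := by
    intro r
    rw [innerQ, eLpNorm_exponent_top]
    refine essSup_le_of_ae_le _ (Eventually.of_forall fun z => ?_)
    exact (hpt z.1 _).trans (le_iSup (fun z : ℝ × hyperplane e =>
      ‖inner ℂ G (gaussL2 ε hb (z.1, r • e + (z.2 : Eucl n)))‖ₑ) z)
  have hpow : (2 : ℝ) ^ (-((n : ℝ) / 2 - 1 / p) * j)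
      * (2 * (((2 : ℝ) ^ (-j)) ^ 2 / 2)) ^ (-((n : ℝ) / 4) + 1 / (2 * p)) = 1 := by
    have : 2 * (((2 : ℝ) ^ (-j)) ^ 2 / 2) = (2 : ℝ) ^ (-2 * (j : ℝ)) := by
      rw [mul_div_cancel₀ _ (two_ne_zero), ← Real.rpow_intCast, ← Real.rpow_natCast,
        ← Real.rpow_mul two_pos.le]
      push_cast
      ring_nf
    rw [this, ← Real.rpow_mul two_pos.le, ← Real.rpow_add two_pos]
    convert Real.rpow_zero 2 using 2
    field_simp
    ring
  calc _ ≤ tp (-((n : ℝ) / 2 - 1 / p) * j) * (‖G‖ₑ * ENNReal.ofReal (decayConst n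
          * (2 * (((2 : ℝ) ^ (-j)) ^ 2 / 2)) ^ (-((n : ℝ) / 4) + 1 / (2 * p)))) := by
        gcongr
        refine le_trans ?_ (lintegral_iSup_enorm_inner_gaussL2_le (by omega) hε hb he hp hnp G)
        gcongr with r
        exact hmax r
    _ = ENNReal.ofReal (decayConst n) * ‖G‖ₑ := by
        rw [tp, mul_left_comm, ← ENNReal.ofReal_mul (by positivity), mul_left_comm, hpow, mul_one,
          mul_comm]
    _ ≤ ENNReal.ofReal (decayConst n)
          * (ENNReal.ofReal (M * Real.exp 2) * eLpNorm φ 2 volume) := by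
        gcongr
        exact enorm_profile_toLp_le hχ hM j hi hφ
    _ = _ := by
        rw [← mul_assoc, ← ENNReal.ofReal_mul (decayConst_pos (by omega)).le]
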